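/- For every p ∈ [1, ∞) and every β > −1 there exists a constant C > 0 (depending only on p and β) such that: for every n ≥ 1, every r ∈ [0, 1), every finite sequence σ = (λ_1, …, λ_n) ∈ D^n with max_i |λ_i| ≤ r, and every f ∈ Hol(D) with ‖f‖_{A^p(β)} ≤ 1 and ‖f‖_{H^∞} < ∞, there exists g ∈ H^∞ interpolating f on σ with ‖g‖_{H^∞} ≤ C · (n/(1−r))^{(2+β)/p}. (Upper bound in Theorem 2.1, weighted Bergman case.) -/

import Mathlib

open Complex Metric

noncomputable section

/-- The elementary Blaschke factor `b_λ(z) = (λ - z)/(1 - conj(λ) z)`. -/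
def blaschkeF (l z : ℂ) : ℂ := (l - z) / (1 - (starRingEnd ℂ) l * z)

/-- The radial-weighted Bergman norm
`‖f‖_{A^p(β)} = (∫_D |f|^p (1-|z|^2)^β dA)^{1/p}`, `dA` normalized area measure. -/
def bergmanNorm (p β : ℝ) (f : ℂ → ℂ) : ℝ :=
  (Real.pi⁻¹ * ∫ z in ball (0:ℂ) 1, ‖f z‖ ^ p * (1 - ‖z‖ ^ 2) ^ β) ^ (1 / p)

open MeasureTheory Set

/-- Area mean value property of holomorphic functions. -/
theorem setIntegral_ball_of_differentiableOn {f : ℂ → ℂ} {U : Set ℂ} {c : ℂ} {R : ℝ}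
    (hf : DifferentiableOn ℂ f U) (hR : 0 < R) (hsub : closedBall c R ⊆ U) :
    ∫ z in ball c R, f z = ((Real.pi * R ^ 2 : ℝ) : ℂ) * f c := by
  have hcirc : ∀ s ∈ Ioo 0 R, ∫ θ in Ioo (-Real.pi) Real.pi, f (circleMap c s θ)
      = (2 * Real.pi : ℝ) * f c := by
    intro s hs
    have h1 : Real.circleAverage f c s = f c := by
      apply DiffContOnCl.circleAverage
      rw [abs_of_pos hs.1]
      apply DifferentiableOn.diffContOnCl
      refine hf.mono ((closure_ball_subset_closedBall).trans ?_)
      exact (closedBall_subset_closedBall hs.2.le).trans hsub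
    rw [← integral_Ioc_eq_integral_Ioo,
      ← intervalIntegral.integral_of_le (by linarith [Real.pi_pos])]
    have h2 := Real.circleAverage_eq_integral_add (f := f) (c := c) (R := s) (-Real.pi)
    rw [h1] at h2
    have hper := (periodic_circleMap c s).comp f
    have h3 := hper.intervalIntegral_add_eq (-Real.pi) 0
    simp only [Function.comp_apply] at h3
    rw [show -Real.pi + 2 * Real.pi = Real.pi by ring] at h3
    rw [h3, zero_add, ← h1, Real.circleAverage_def, Complex.real_smul]
    have := Real.pi_ne_zero
    push_cast
    field_simp
  have hcont : ContinuousOn (fun p : ℝ × ℝ => (p.1 : ℂ) * f (circleMap c p.1 p.2))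
      (Icc 0 R ×ˢ Icc (-Real.pi) Real.pi) := by
    refine ContinuousOn.mul (by fun_prop) (hf.continuousOn.comp ?_ ?_)
    · unfold circleMap; fun_prop
    · intro p hp
      apply hsub
      have := circleMap_mem_closedBall c hp.1.1 p.2
      exact closedBall_subset_closedBall hp.1.2 this
  have hint : IntegrableOn (fun p : ℝ × ℝ => (p.1 : ℂ) * f (circleMap c p.1 p.2))
      (Ioo 0 R ×ˢ Ioo (-Real.pi) Real.pi) :=
    (hcont.integrableOn_compact (isCompact_Icc.prod isCompact_Icc)).mono_set
      (prod_mono Ioo_subset_Icc_self Ioo_subset_Icc_self)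
  calc ∫ z in ball c R, f z = ∫ z, (ball c R).indicator f z :=
        (integral_indicator measurableSet_ball).symm
    _ = ∫ z, (ball c R).indicator f (c + z) := (integral_add_left_eq_self _ c).symm
    _ = ∫ p in polarCoord.target, p.1 • (ball c R).indicator f (c + Complex.polarCoord.symm p) :=
        (Complex.integral_comp_polarCoord_symm _).symm
    _ = ∫ p in polarCoord.target, (Ioo 0 R ×ˢ Ioo (-Real.pi) Real.pi).indicator
          (fun p : ℝ × ℝ => (p.1 : ℂ) * f (circleMap c p.1 p.2)) p := by
        refine setIntegral_congr_fun polarCoord.open_target.measurableSet ?_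
        rintro ⟨s, θ⟩ ⟨hs, hθ⟩
        simp only [mem_Ioi] at hs
        have he : c + Complex.polarCoord.symm (s, θ) = circleMap c s θ := by
          rw [Complex.polarCoord_symm_apply, circleMap, Complex.exp_mul_I]
          simp
        simp only [he]
        by_cases h : s < R
        · rw [indicator_of_mem, indicator_of_mem, Complex.real_smul]
          · exact ⟨⟨hs, h⟩, hθ⟩
          · simpa [mem_ball, dist_eq_norm, abs_of_pos hs] using h
        · rw [indicator_of_notMem, indicator_of_notMem, smul_zero]
          · exact fun hh => h hh.1.2
          · simpa [mem_ball, dist_eq_norm, abs_of_pos hs] using h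
    _ = ∫ p in Ioo 0 R ×ˢ Ioo (-Real.pi) Real.pi, (p.1 : ℂ) * f (circleMap c p.1 p.2) := by
        rw [setIntegral_indicator (measurableSet_Ioo.prod measurableSet_Ioo),
          inter_eq_self_of_subset_right]
        exact prod_mono Ioo_subset_Ioi_self subset_rfl
    _ = ∫ s in Ioo 0 R, ∫ θ in Ioo (-Real.pi) Real.pi, (s : ℂ) * f (circleMap c s θ) := by
        rw [Measure.volume_eq_prod] at hint ⊢
        rw [setIntegral_prod _ hint]
    _ = ∫ s in Ioo 0 R, (s : ℂ) * ((2 * Real.pi : ℝ) * f c) := by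
        refine setIntegral_congr_fun measurableSet_Ioo fun s hs => ?_
        rw [integral_const_mul, hcirc s hs]
    _ = ((Real.pi * R ^ 2 : ℝ) : ℂ) * f c := by
        rw [integral_mul_const, integral_complex_ofReal, ← integral_Ioc_eq_integral_Ioo,
          ← intervalIntegral.integral_of_le hR.le, integral_id]
        push_cast
        ring

theorem integrableOn_bergman_weight {β : ℝ} (hβ : -1 < β) :
    IntegrableOn (fun z : ℂ => (1 - ‖z‖ ^ 2) ^ β) (ball (0 : ℂ) 1) := by
  rw [integrableOn_fun_norm_addHaar volume (f := fun t : ℝ => (1 - t ^ 2) ^ β)]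
  have h1 : IntegrableOn (fun y : ℝ => (1 - y) ^ β) (Icc 0 1) := by
    have h := (intervalIntegral.intervalIntegrable_rpow' (a := 0) (b := 1) hβ).comp_sub_left 1
    rw [sub_zero, sub_self] at h
    exact (intervalIntegrable_iff_integrableOn_Icc_of_le zero_le_one).1 h.symm
  have h2 : ContinuousOn (fun y : ℝ => y * (1 + y) ^ β) (Icc 0 1) := by
    refine continuousOn_id.mul (ContinuousOn.rpow_const (by fun_prop) ?_)
    intro x hx
    left
    linarith [hx.1]
  refine ((h1.continuousOn_mul h2 isCompact_Icc).mono_set Ioo_subset_Icc_self).congr_fun ?_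
    measurableSet_Ioo
  intro y hy
  simp only [Complex.finrank_real_complex, smul_eq_mul]
  rw [show (1 : ℝ) - y ^ 2 = (1 - y) * (1 + y) by ring,
    Real.mul_rpow (by linarith [hy.2]) (by linarith [hy.1])]
  ring

/-- Near a point `w` of the disc, the Bergman weight is at least a multiple of
`(1 - ‖w‖) ^ β`. -/
theorem exists_bergman_weight_lower_bound (β : ℝ) :
    ∃ c : ℝ, 0 < c ∧ ∀ w ∈ ball (0 : ℂ) 1, ∀ z ∈ ball w ((1 - ‖w‖) / 2),
      c * (1 - ‖w‖) ^ β ≤ (1 - ‖z‖ ^ 2) ^ β := by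
  refine ⟨min ((1 / 2) ^ β) (3 ^ β), by positivity, fun w hw z hz => ?_⟩
  rw [mem_ball_zero_iff] at hw
  rw [mem_ball, dist_eq_norm] at hz
  have h1 : ‖z‖ ≤ ‖z - w‖ + ‖w‖ := by simpa using norm_add_le (z - w) w
  have h2 : ‖w‖ ≤ ‖z - w‖ + ‖z‖ := by
    rw [norm_sub_rev]; simpa using norm_add_le (w - z) z
  have h0 := norm_nonneg z
  have h3 : (1 / 2) * (1 - ‖w‖) ≤ 1 - ‖z‖ ^ 2 := by nlinarith
  have h4 : 1 - ‖z‖ ^ 2 ≤ 3 * (1 - ‖w‖) := by nlinarith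
  have hw0 : 0 < 1 - ‖w‖ := by linarith
  rcases le_total 0 β with hb | hb
  · calc _ ≤ (1 / 2) ^ β * (1 - ‖w‖) ^ β := by
          gcongr
          exact min_le_left _ _
      _ = ((1 / 2) * (1 - ‖w‖)) ^ β := (Real.mul_rpow (by norm_num) hw0.le).symm
      _ ≤ _ := by gcongr
  · calc _ ≤ 3 ^ β * (1 - ‖w‖) ^ β := by
          gcongr
          exact min_le_right _ _
      _ = (3 * (1 - ‖w‖)) ^ β := (Real.mul_rpow (by norm_num) hw0.le).symm
      _ ≤ _ := Real.rpow_le_rpow_of_nonpos (by nlinarith) h4 hb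

/-- Pointwise growth of functions in the unit ball of a weighted Bergman space. -/
theorem exists_bergman_growth_bound {p β : ℝ} (hp : 1 ≤ p) (hβ : -1 < β) :
    ∃ A : ℝ, 0 < A ∧ ∀ f : ℂ → ℂ, DifferentiableOn ℂ f (ball (0 : ℂ) 1) →
      bergmanNorm p β f ≤ 1 → (∃ M : ℝ, ∀ z ∈ ball (0 : ℂ) 1, ‖f z‖ ≤ M) →
      ∀ w ∈ ball (0 : ℂ) 1, ‖f w‖ ≤ A * (1 - ‖w‖) ^ (-((2 + β) / p)) := by
  obtain ⟨c, hc, hweight⟩ := exists_bergman_weight_lower_bound β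
  have hp0 : 0 < p := by linarith
  refine ⟨(4 / c) ^ (1 / p), by positivity, fun f hf hnorm ⟨M, hM⟩ w hw => ?_⟩
  have hw' := mem_ball_zero_iff.1 hw
  set R := (1 - ‖w‖) / 2 with hR
  have hR0 : 0 < R := by rw [hR]; linarith
  have hsub : closedBall w R ⊆ ball (0 : ℂ) 1 := by
    intro z hz
    rw [mem_closedBall, dist_eq_norm] at hz
    rw [mem_ball_zero_iff]
    have h1 : ‖z‖ ≤ ‖z - w‖ + ‖w‖ := by simpa using norm_add_le (z - w) w
    linarith
  have hsub' : ball w R ⊆ ball (0 : ℂ) 1 := ball_subset_closedBall.trans hsub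
  have hcn : ContinuousOn (fun z => ‖f z‖ ^ p) (ball (0 : ℂ) 1) :=
    hf.continuousOn.norm.rpow_const fun _ _ => Or.inr hp0.le
  have hvol : (volume (ball w R)).toReal = Real.pi * R ^ 2 := by
    simp [Complex.volume_ball, hR0.le, mul_comm]
  have hvol' : volume.real (ball w R) = Real.pi * R ^ 2 := hvol
  -- the weighted integral is at most `π`
  have hI : ∫ z in ball (0 : ℂ) 1, ‖f z‖ ^ p * (1 - ‖z‖ ^ 2) ^ β ≤ Real.pi := by
    by_contra! hcon
    have h1 : 1 < Real.pi⁻¹ * ∫ z in ball (0 : ℂ) 1, ‖f z‖ ^ p * (1 - ‖z‖ ^ 2) ^ β := by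
      rw [inv_mul_eq_div, one_lt_div Real.pi_pos]
      exact hcon
    have := Real.one_lt_rpow h1 (show 0 < 1 / p by positivity)
    exact absurd hnorm (not_le.2 this)
  have hint : IntegrableOn (fun z => ‖f z‖ ^ p * (1 - ‖z‖ ^ 2) ^ β) (ball (0 : ℂ) 1) := by
    refine Integrable.bdd_mul (c := |M| ^ p) (integrableOn_bergman_weight hβ)
      (hcn.aestronglyMeasurable measurableSet_ball) ?_
    refine (ae_restrict_iff' measurableSet_ball).2 (.of_forall fun z hz => ?_)
    rw [Real.norm_of_nonneg (by positivity)]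
    gcongr
    exact (hM z hz).trans (le_abs_self M)
  have hcb : IntegrableOn (fun z => ‖f z‖ ^ p) (ball w R) :=
    ((hcn.mono hsub).integrableOn_compact (isCompact_closedBall w R)).mono_set
      ball_subset_closedBall
  have hfb : IntegrableOn (fun z => ‖f z‖) (ball w R) :=
    ((hf.continuousOn.norm.mono hsub).integrableOn_compact (isCompact_closedBall w R)).mono_set
      ball_subset_closedBall
  have hlow : (c * (1 - ‖w‖) ^ β) * ∫ z in ball w R, ‖f z‖ ^ p ≤ Real.pi := by
    rw [← integral_const_mul]
    refine le_trans ?_ hI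
    refine le_trans (setIntegral_mono_on (hcb.const_mul _) (hint.mono_set hsub')
      measurableSet_ball fun z hz => ?_) (setIntegral_mono_set hint ?_ hsub'.eventuallyLE)
    · rw [mul_comm]
      gcongr
      exact hweight w hw z hz
    · refine (ae_restrict_iff' measurableSet_ball).2 (.of_forall fun z hz => ?_)
      have : ‖z‖ < 1 := mem_ball_zero_iff.1 hz
      have : 0 ≤ 1 - ‖z‖ ^ 2 := by nlinarith [norm_nonneg z]
      simp only [Pi.zero_apply]
      positivity
  have hmean : ‖f w‖ ≤ ⨍ z in ball w R, ‖f z‖ := by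
    rw [setAverage_eq, hvol', smul_eq_mul, inv_mul_eq_div, le_div_iff₀ (by positivity)]
    have h := setIntegral_ball_of_differentiableOn hf hR0 hsub
    calc ‖f w‖ * (Real.pi * R ^ 2) = ‖((Real.pi * R ^ 2 : ℝ) : ℂ) * f w‖ := by
          rw [norm_mul, Complex.norm_real, Real.norm_of_nonneg (by positivity), mul_comm]
      _ ≤ _ := by rw [← h]; exact norm_integral_le_integral_norm _
  have hjen : ‖f w‖ ^ p ≤ ⨍ z in ball w R, ‖f z‖ ^ p := by
    refine le_trans (Real.rpow_le_rpow (norm_nonneg _) hmean hp0.le) ?_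
    refine (convexOn_rpow hp).map_set_average_le
      (Real.continuous_rpow_const hp0.le).continuousOn isClosed_Ici
      (measure_ball_pos _ _ hR0).ne' measure_ball_lt_top.ne
      (.of_forall fun z => norm_nonneg _) hfb hcb
  rw [setAverage_eq, hvol', smul_eq_mul, inv_mul_eq_div, le_div_iff₀ (by positivity)] at hjen
  have hd : 0 < 1 - ‖w‖ := by linarith
  have hfin : ‖f w‖ ^ p ≤ (4 / c) * (1 - ‖w‖) ^ (-(2 + β)) := by
    have h1 : (c * (1 - ‖w‖) ^ β) * (‖f w‖ ^ p * (Real.pi * R ^ 2)) ≤ Real.pi :=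
      le_trans (by gcongr) hlow
    have h2 : ‖f w‖ ^ p * ((c / 4) * ((1 - ‖w‖) ^ β * (1 - ‖w‖) ^ 2)) ≤ 1 := by
      refine le_of_mul_le_mul_left ?_ Real.pi_pos
      calc _ = (c * (1 - ‖w‖) ^ β) * (‖f w‖ ^ p * (Real.pi * R ^ 2)) := by rw [hR]; ring
        _ ≤ _ := by simpa using h1
    rw [Real.rpow_neg hd.le, Real.rpow_add hd, Real.rpow_two, mul_comm (_ ^ 2 : ℝ)]
    rw [← le_div_iff₀ (by positivity)] at h2
    refine h2.trans_eq ?_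
    field_simp
  calc ‖f w‖ = (‖f w‖ ^ p) ^ (1 / p) := by
        rw [← Real.rpow_mul (norm_nonneg _), mul_one_div_cancel hp0.ne', Real.rpow_one]
    _ ≤ ((4 / c) * (1 - ‖w‖) ^ (-(2 + β))) ^ (1 / p) := by gcongr
    _ = _ := by
        rw [Real.mul_rpow (by positivity) (by positivity), ← Real.rpow_mul hd.le]
        congr 2
        ring

theorem one_sub_mul_conj_ne_zero {z w : ℂ} (hz : ‖z‖ < 1) (hw : ‖w‖ < 1) :
    1 - z * (starRingEnd ℂ) w ≠ 0 := by
  intro h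
  have h1 : ‖z * (starRingEnd ℂ) w‖ = 1 := by rw [← sub_eq_zero.1 h, norm_one]
  rw [norm_mul, RCLike.norm_conj] at h1
  nlinarith [norm_nonneg z, norm_nonneg w]

theorem one_sub_conj_mul_ne_zero {l z : ℂ} (hl : ‖l‖ < 1) (hz : ‖z‖ < 1) :
    1 - (starRingEnd ℂ) l * z ≠ 0 := by
  rw [mul_comm]
  exact one_sub_mul_conj_ne_zero hz hl

theorem one_sub_blaschkeF_mul_conj {l z w : ℂ} (hl : ‖l‖ < 1) (hz : ‖z‖ < 1) (hw : ‖w‖ < 1) :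
    1 - blaschkeF l z * (starRingEnd ℂ) (blaschkeF l w) =
      (1 - (‖l‖ : ℂ) ^ 2) * (1 - z * (starRingEnd ℂ) w) /
        ((1 - (starRingEnd ℂ) l * z) * (1 - l * (starRingEnd ℂ) w)) := by
  have h1 := one_sub_conj_mul_ne_zero hl hz
  have h2 := one_sub_mul_conj_ne_zero hl hw
  rw [← Complex.mul_conj']
  simp only [blaschkeF, map_div₀, map_sub, map_mul, map_one, Complex.conj_conj]
  rw [div_mul_div_comm, eq_div_iff (mul_ne_zero h1 h2), sub_mul,
    div_mul_cancel₀ _ (mul_ne_zero h1 h2)]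
  ring

theorem norm_one_sub_blaschkeF_mul_conj_le {l z w : ℂ} {r : ℝ} (hr : r < 1) (hl : ‖l‖ ≤ r)
    (hz : ‖z‖ < 1) (hw : ‖w‖ < 1) :
    ‖1 - blaschkeF l z * (starRingEnd ℂ) (blaschkeF l w)‖ ≤
      2 / (1 - r) * ‖1 - z * (starRingEnd ℂ) w‖ := by
  have hl1 : ‖l‖ < 1 := hl.trans_lt hr
  have hl0 := norm_nonneg l
  have key : ∀ v : ℂ, ‖v‖ < 1 → 1 - ‖l‖ ≤ ‖1 - v * l‖ := by
    intro v hv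
    have h := norm_sub_norm_le (1 : ℂ) (v * l)
    rw [norm_one, norm_mul] at h
    nlinarith
  have h1 : 1 - ‖l‖ ≤ ‖1 - (starRingEnd ℂ) l * z‖ := by
    have := key ((starRingEnd ℂ) z) (by rwa [RCLike.norm_conj])
    have e : (starRingEnd ℂ) (1 - (starRingEnd ℂ) l * z) = 1 - (starRingEnd ℂ) z * l := by
      simp [mul_comm]
    rwa [← RCLike.norm_conj (1 - (starRingEnd ℂ) l * z), e]
  have h2 : 1 - ‖l‖ ≤ ‖1 - l * (starRingEnd ℂ) w‖ := by
    have := key ((starRingEnd ℂ) w) (by rwa [RCLike.norm_conj])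
    rwa [mul_comm] at this
  have h3 : ‖(1 : ℂ) - (‖l‖ : ℂ) ^ 2‖ = 1 - ‖l‖ ^ 2 := by
    rw [← Complex.ofReal_pow, ← Complex.ofReal_one, ← Complex.ofReal_sub, Complex.norm_real,
      Real.norm_of_nonneg (by nlinarith)]
  rw [one_sub_blaschkeF_mul_conj hl1 hz hw, norm_div, norm_mul, norm_mul, h3, mul_div_right_comm]
  refine mul_le_mul_of_nonneg_right ?_ (norm_nonneg _)
  have hd : 0 < 1 - ‖l‖ := by linarith
  calc (1 - ‖l‖ ^ 2) / (‖1 - (starRingEnd ℂ) l * z‖ * ‖1 - l * (starRingEnd ℂ) w‖)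
      ≤ (1 - ‖l‖ ^ 2) / ((1 - ‖l‖) * (1 - ‖l‖)) := by
        have : 0 ≤ 1 - ‖l‖ ^ 2 := by nlinarith
        gcongr
    _ = (1 + ‖l‖) / (1 - ‖l‖) := by field_simp; ring
    _ ≤ 2 / (1 - r) := by
        have : 0 < 1 - r := by linarith
        gcongr
        linarith

theorem norm_blaschkeF_le_one {l z : ℂ} (hl : ‖l‖ < 1) (hz : ‖z‖ < 1) :
    ‖blaschkeF l z‖ ≤ 1 := by
  have h := one_sub_blaschkeF_mul_conj hl hz hz
  have hd : (1 - (starRingEnd ℂ) l * z) * (1 - l * (starRingEnd ℂ) z) =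
      ((‖1 - (starRingEnd ℂ) l * z‖ ^ 2 : ℝ) : ℂ) := by
    push_cast
    rw [← Complex.mul_conj']
    simp
  rw [hd, Complex.mul_conj', Complex.mul_conj'] at h
  norm_cast at h
  have h0 : 0 ≤ 1 - ‖blaschkeF l z‖ ^ 2 := by
    rw [h]
    have h1 : 0 ≤ 1 - ‖l‖ ^ 2 := by nlinarith [norm_nonneg l]
    have h2 : 0 ≤ 1 - ‖z‖ ^ 2 := by nlinarith [norm_nonneg z]
    positivity
  nlinarith [norm_nonneg (blaschkeF l z)]

theorem differentiableOn_blaschkeF {l : ℂ} (hl : ‖l‖ < 1) :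
    DifferentiableOn ℂ (blaschkeF l) (ball (0 : ℂ) 1) := by
  unfold blaschkeF
  refine DifferentiableOn.div (by fun_prop) (by fun_prop) fun z hz => ?_
  exact one_sub_conj_mul_ne_zero hl (mem_ball_zero_iff.1 hz)

theorem norm_one_sub_prod_le {ι : Type*} (s : Finset ι) (x : ι → ℂ) (hx : ∀ i, ‖x i‖ ≤ 1) :
    ‖1 - ∏ i ∈ s, x i‖ ≤ ∑ i ∈ s, ‖1 - x i‖ := by
  classical
  induction s using Finset.induction_on with
  | empty => simp
  | insert i s hi ih =>
    rw [Finset.prod_insert hi, Finset.sum_insert hi]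
    calc ‖1 - x i * ∏ j ∈ s, x j‖ = ‖(1 - x i) + x i * (1 - ∏ j ∈ s, x j)‖ := by ring_nf
      _ ≤ ‖1 - x i‖ + ‖x i‖ * ‖1 - ∏ j ∈ s, x j‖ := by
        rw [← norm_mul]; exact norm_add_le _ _
      _ ≤ ‖1 - x i‖ + ∑ j ∈ s, ‖1 - x j‖ := by
        gcongr
        exact (mul_le_of_le_one_left (norm_nonneg _) (hx i)).trans ih

/-- The finite Blaschke product with zeros `σ`. -/
def blaschkeProd {n : ℕ} (σ : Fin n → ℂ) (z : ℂ) : ℂ := ∏ i, blaschkeF (σ i) z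

theorem norm_blaschkeProd_le_one {n : ℕ} {σ : Fin n → ℂ} (hσ : ∀ i, ‖σ i‖ < 1) {z : ℂ}
    (hz : ‖z‖ < 1) : ‖blaschkeProd σ z‖ ≤ 1 := by
  rw [blaschkeProd, norm_prod]
  exact Finset.prod_le_one (fun _ _ => norm_nonneg _) fun i _ => norm_blaschkeF_le_one (hσ i) hz

theorem differentiableOn_blaschkeProd {n : ℕ} {σ : Fin n → ℂ} (hσ : ∀ i, ‖σ i‖ < 1) :
    DifferentiableOn ℂ (blaschkeProd σ) (ball (0 : ℂ) 1) := by
  unfold blaschkeProd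
  exact DifferentiableOn.fun_finsetProd fun i _ => differentiableOn_blaschkeF (hσ i)

theorem norm_one_sub_blaschkeProd_mul_conj_le {n : ℕ} {σ : Fin n → ℂ} {r : ℝ} (hr : r < 1)
    (hσ : ∀ i, ‖σ i‖ ≤ r) {z w : ℂ} (hz : ‖z‖ < 1) (hw : ‖w‖ < 1) :
    ‖1 - blaschkeProd σ z * (starRingEnd ℂ) (blaschkeProd σ w)‖ ≤
      2 * n / (1 - r) * ‖1 - z * (starRingEnd ℂ) w‖ := by
  have hσ1 : ∀ i, ‖σ i‖ < 1 := fun i => (hσ i).trans_lt hr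
  rw [blaschkeProd, blaschkeProd, map_prod, ← Finset.prod_mul_distrib]
  refine (norm_one_sub_prod_le _ _ fun i => ?_).trans ?_
  · rw [norm_mul, RCLike.norm_conj]
    exact mul_le_one₀ (norm_blaschkeF_le_one (hσ1 i) hz) (norm_nonneg _)
      (norm_blaschkeF_le_one (hσ1 i) hw)
  · refine (Finset.sum_le_sum fun i _ =>
      norm_one_sub_blaschkeF_mul_conj_le hr (hσ i) hz hw).trans_eq ?_
    simp
    ring

/-- The model space kernel is controlled by a dilated Szegő kernel. -/
theorem norm_model_kernel_le {n : ℕ} (hn : 1 ≤ n) {σ : Fin n → ℂ} {r : ℝ} (hr : r < 1)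
    (hσ : ∀ i, ‖σ i‖ ≤ r) {z w : ℂ} (hz : ‖z‖ < 1) (hw : ‖w‖ < 1) {ρ : ℝ}
    (hρ0 : 0 ≤ ρ) (hρ : ρ = 1 - (1 - r) / (2 * n)) :
    ‖(1 - blaschkeProd σ z * (starRingEnd ℂ) (blaschkeProd σ w)) /
        (1 - z * (starRingEnd ℂ) w)‖ ≤ 3 / ‖1 - ρ * z * (starRingEnd ℂ) w‖ := by
  have hσ1 : ∀ i, ‖σ i‖ < 1 := fun i => (hσ i).trans_lt hr
  have hn0 : (0 : ℝ) < n := by exact_mod_cast hn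
  have hr0 : 0 < 1 - r := by linarith
  have hρ1 : ρ < 1 := by
    rw [hρ]
    linarith [show 0 < (1 - r) / (2 * n) by positivity]
  set Q := 1 - blaschkeProd σ z * (starRingEnd ℂ) (blaschkeProd σ w) with hQ
  have hne := norm_pos_iff.2 (one_sub_mul_conj_ne_zero hz hw)
  have hρz : ‖(ρ : ℂ) * z‖ < 1 := by
    rw [norm_mul, Complex.norm_real, Real.norm_of_nonneg hρ0]
    nlinarith [norm_nonneg z]
  have hne' := norm_pos_iff.2 (one_sub_mul_conj_ne_zero hρz hw)
  have hQ2 : ‖Q‖ ≤ 2 := by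
    refine (norm_sub_le _ _).trans ?_
    rw [norm_one, norm_mul, RCLike.norm_conj]
    have := mul_le_one₀ (norm_blaschkeProd_le_one hσ1 hz) (norm_nonneg _)
      (norm_blaschkeProd_le_one hσ1 hw)
    linarith
  have hQM := norm_one_sub_blaschkeProd_mul_conj_le hr hσ hz hw
  rw [← hQ] at hQM
  have hdil : ‖1 - ρ * z * (starRingEnd ℂ) w‖ ≤
      ‖1 - z * (starRingEnd ℂ) w‖ + (1 - r) / (2 * n) := by
    have : 1 - ρ * z * (starRingEnd ℂ) w =
        (1 - z * (starRingEnd ℂ) w) + (((1 - ρ : ℝ) : ℂ) * (z * (starRingEnd ℂ) w)) := by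
      push_cast; ring
    rw [this]
    refine (norm_add_le _ _).trans ?_
    gcongr
    rw [norm_mul, norm_mul, RCLike.norm_conj, Complex.norm_real,
      Real.norm_of_nonneg (by linarith)]
    have h1 : ‖z‖ * ‖w‖ ≤ 1 := mul_le_one₀ hz.le (norm_nonneg _) hw.le
    have h2 : 1 - ρ = (1 - r) / (2 * n) := by rw [hρ]; ring
    rw [h2]
    exact mul_le_of_le_one_right (by positivity) h1
  rw [norm_div, div_le_div_iff₀ hne hne']
  calc ‖Q‖ * ‖1 - ρ * z * (starRingEnd ℂ) w‖
      ≤ ‖Q‖ * (‖1 - z * (starRingEnd ℂ) w‖ + (1 - r) / (2 * n)) := by gcongr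
    _ = ‖Q‖ * ‖1 - z * (starRingEnd ℂ) w‖ + ‖Q‖ * ((1 - r) / (2 * n)) := by ring
    _ ≤ 2 * ‖1 - z * (starRingEnd ℂ) w‖ +
        (2 * n / (1 - r) * ‖1 - z * (starRingEnd ℂ) w‖) * ((1 - r) / (2 * n)) := by gcongr
    _ = 3 * ‖1 - z * (starRingEnd ℂ) w‖ := by field_simp; ring

/-- The `L²` norm of the Szegő kernel over the unit circle. -/
theorem integral_inv_norm_one_sub_mul_conj_sq {ζ : ℂ} (hζ : ‖ζ‖ < 1) :
    ∫ θ in (0 : ℝ)..2 * Real.pi, 1 / ‖1 - ζ * (starRingEnd ℂ) (circleMap 0 1 θ)‖ ^ 2 =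
      2 * Real.pi / (1 - ‖ζ‖ ^ 2) := by
  have hdiff : DiffContOnCl ℂ (fun w => (1 - (starRingEnd ℂ) ζ * w)⁻¹) (ball (0 : ℂ) |1|) := by
    apply DifferentiableOn.diffContOnCl
    refine DifferentiableOn.inv (by fun_prop) fun w hw => ?_
    rw [abs_one, closure_ball _ one_ne_zero, mem_closedBall_zero_iff] at hw
    intro h
    have h1 : ‖(starRingEnd ℂ) ζ * w‖ = 1 := by rw [← sub_eq_zero.1 h, norm_one]
    rw [norm_mul, RCLike.norm_conj] at h1
    nlinarith [norm_nonneg ζ, norm_nonneg w]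
  have h := hdiff.circleAverage_smul_div (w := ζ) (by simpa using hζ)
  rw [Real.circleAverage_def] at h
  have hcongr : ∀ θ : ℝ, ((circleMap 0 1 θ - 0) / (circleMap 0 1 θ - ζ)) •
      (1 - (starRingEnd ℂ) ζ * circleMap 0 1 θ)⁻¹ =
      ((1 / ‖1 - ζ * (starRingEnd ℂ) (circleMap 0 1 θ)‖ ^ 2 : ℝ) : ℂ) := by
    intro θ
    set w := circleMap 0 1 θ with hw
    have hw1 : w * (starRingEnd ℂ) w = 1 := by
      rw [Complex.mul_conj', hw, norm_circleMap_zero]; simp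
    have hw0 : w ≠ 0 := by
      intro h0; simp [h0] at hw1
    push_cast
    rw [← Complex.mul_conj']
    have : w - ζ = w * (1 - ζ * (starRingEnd ℂ) w) := by
      linear_combination ζ * hw1
    rw [this, sub_zero, smul_eq_mul]
    simp only [map_sub, map_one, map_mul, Complex.conj_conj]
    rw [mul_comm w, div_mul_cancel_right₀ hw0, one_div, mul_inv]
  simp_rw [hcongr] at h
  rw [intervalIntegral.integral_ofReal, mul_comm ((starRingEnd ℂ) ζ), Complex.mul_conj',
    Complex.real_smul] at h
  norm_cast at h
  have := Real.pi_pos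
  rw [inv_mul_eq_iff_eq_mul₀ (by positivity)] at h
  rw [h, div_eq_mul_inv]

theorem integral_inv_norm_one_sub_mul_conj_pow_le {ζ : ℂ} (hζ : ‖ζ‖ < 1) (m : ℕ) :
    ∫ θ in (0 : ℝ)..2 * Real.pi, 1 / ‖1 - ζ * (starRingEnd ℂ) (circleMap 0 1 θ)‖ ^ (m + 2) ≤
      2 * Real.pi * (1 / (1 - ‖ζ‖)) ^ (m + 1) := by
  have hlow : ∀ θ : ℝ, 1 - ‖ζ‖ ≤ ‖1 - ζ * (starRingEnd ℂ) (circleMap 0 1 θ)‖ := by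
    intro θ
    have h := norm_sub_norm_le (1 : ℂ) (ζ * (starRingEnd ℂ) (circleMap 0 1 θ))
    rwa [norm_one, norm_mul, RCLike.norm_conj, norm_circleMap_zero, abs_one, mul_one] at h
  have hpos : 0 < 1 - ‖ζ‖ := by linarith
  have hp : ∀ θ : ℝ, 0 < ‖1 - ζ * (starRingEnd ℂ) (circleMap 0 1 θ)‖ :=
    fun θ => hpos.trans_le (hlow θ)
  have hcont : ∀ k : ℕ, Continuous fun θ : ℝ =>
      1 / ‖1 - ζ * (starRingEnd ℂ) (circleMap 0 1 θ)‖ ^ k := by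
    intro k
    refine continuous_const.div ?_ fun θ => (pow_pos (hp θ) k).ne'
    have := Complex.continuous_conj
    unfold circleMap
    fun_prop
  have hpi := Real.pi_pos
  calc _ ≤ ∫ θ in (0 : ℝ)..2 * Real.pi, (1 / (1 - ‖ζ‖)) ^ m *
          (1 / ‖1 - ζ * (starRingEnd ℂ) (circleMap 0 1 θ)‖ ^ 2) := by
        refine intervalIntegral.integral_mono_on (by positivity)
          ((hcont _).intervalIntegrable _ _)
          (((hcont 2).const_smul ((1 / (1 - ‖ζ‖)) ^ m)).intervalIntegrable _ _) fun θ _ => ?_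
        have := hp θ
        rw [pow_add, one_div, mul_inv, ← inv_pow, one_div, one_div]
        gcongr
        exact hlow θ
    _ = (1 / (1 - ‖ζ‖)) ^ m * (2 * Real.pi / (1 - ‖ζ‖ ^ 2)) := by
        rw [intervalIntegral.integral_const_mul, integral_inv_norm_one_sub_mul_conj_sq hζ]
    _ ≤ (1 / (1 - ‖ζ‖)) ^ m * (2 * Real.pi / (1 - ‖ζ‖)) := by
        gcongr
        nlinarith [norm_nonneg ζ]
    _ = _ := by ring

/-- The parameter domain `{(u, θ)}` for the polar parametrization `√u e^{iθ}` of the disc. -/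
def polarStrip : Set (ℝ × ℝ) := Ioo 0 1 ×ˢ Ioo 0 (2 * Real.pi)

/-- The point `√u e^{iθ}` of the disc. -/
def polarPoint (x : ℝ × ℝ) : ℂ := circleMap 0 (√x.1) x.2

/-- The weighted Bergman projection with weight `(1 - |w|²)^m`, in the coordinates
`w = √u e^{iθ}`. -/
def bergmanOp (m : ℕ) (φ : ℂ → ℂ) (z : ℂ) : ℂ :=
  ((m + 1) / (2 * Real.pi)) * ∫ x in polarStrip, (1 - x.1) ^ m * φ (polarPoint x) /
    (1 - z * (starRingEnd ℂ) (polarPoint x)) ^ (m + 2)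

theorem measurableSet_polarStrip : MeasurableSet polarStrip :=
  measurableSet_Ioo.prod measurableSet_Ioo

theorem volume_polarStrip_lt_top : volume polarStrip < ⊤ := by
  refine (measure_mono (prod_mono Ioo_subset_Icc_self Ioo_subset_Icc_self)).trans_lt
    (isCompact_Icc.prod isCompact_Icc).measure_lt_top

@[fun_prop]
theorem continuous_polarPoint : Continuous polarPoint := by
  unfold polarPoint circleMap
  fun_prop

@[fun_prop]
theorem continuous_conj_polarPoint : Continuous fun x => (starRingEnd ℂ) (polarPoint x) :=
  Complex.continuous_conj.comp continuous_polarPoint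

theorem norm_polarPoint (x : ℝ × ℝ) : ‖polarPoint x‖ = √x.1 := by
  rw [polarPoint, norm_circleMap_zero, abs_of_nonneg (Real.sqrt_nonneg _)]

theorem norm_polarPoint_lt_one {x : ℝ × ℝ} (hx : x ∈ polarStrip) : ‖polarPoint x‖ < 1 := by
  rw [norm_polarPoint, Real.sqrt_lt' one_pos]
  simpa using hx.1.2

theorem one_sub_norm_le_norm_one_sub_mul_conj {z w : ℂ} (hw : ‖w‖ < 1) :
    1 - ‖z‖ ≤ ‖1 - z * (starRingEnd ℂ) w‖ := by
  have h := norm_sub_norm_le (1 : ℂ) (z * (starRingEnd ℂ) w)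
  rw [norm_one, norm_mul, RCLike.norm_conj] at h
  nlinarith [norm_nonneg z]

theorem continuousOn_comp_polarPoint {φ : ℂ → ℂ} (hφ : ContinuousOn φ (ball (0 : ℂ) 1)) :
    ContinuousOn (fun x => φ (polarPoint x)) polarStrip :=
  hφ.comp continuous_polarPoint.continuousOn
    fun _ hx => mem_ball_zero_iff.2 (norm_polarPoint_lt_one hx)

theorem continuousOn_bergmanOp_integrand {φ : ℂ → ℂ} (hφ : ContinuousOn φ (ball (0 : ℂ) 1))
    (m k : ℕ) {z : ℂ} (hz : ‖z‖ < 1) :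
    ContinuousOn (fun x : ℝ × ℝ => (1 - x.1 : ℂ) ^ m * φ (polarPoint x) /
      (1 - z * (starRingEnd ℂ) (polarPoint x)) ^ k) polarStrip := by
  have h := continuousOn_comp_polarPoint hφ
  refine ContinuousOn.div (ContinuousOn.mul (by fun_prop) h) (by fun_prop) fun x hx => ?_
  exact pow_ne_zero _ (one_sub_mul_conj_ne_zero hz (norm_polarPoint_lt_one hx))

theorem norm_bergmanOp_integrand_le {φ : ℂ → ℂ} {M : ℝ} (hM : ∀ z ∈ ball (0 : ℂ) 1, ‖φ z‖ ≤ M)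
    (m k : ℕ) {z : ℂ} {ρ : ℝ} (hρ : ρ < 1) (hz : ‖z‖ ≤ ρ) {x : ℝ × ℝ} (hx : x ∈ polarStrip) :
    ‖(1 - x.1 : ℂ) ^ m * φ (polarPoint x) /
      (1 - z * (starRingEnd ℂ) (polarPoint x)) ^ k‖ ≤ M / (1 - ρ) ^ k := by
  have hw := norm_polarPoint_lt_one hx
  have h1 : ‖(1 - x.1 : ℂ) ^ m‖ ≤ 1 := by
    rw [norm_pow, ← Complex.ofReal_one, ← Complex.ofReal_sub, Complex.norm_real,
      Real.norm_of_nonneg (by linarith [hx.1.2])]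
    exact pow_le_one₀ (by linarith [hx.1.2]) (by linarith [hx.1.1])
  have h2 := hM _ (mem_ball_zero_iff.2 hw)
  have h3 := one_sub_norm_le_norm_one_sub_mul_conj (z := z) hw
  have hM0 : 0 ≤ M := (norm_nonneg _).trans h2
  rw [norm_div, norm_mul, norm_pow (1 - z * _)]
  have : 0 < 1 - ρ := by linarith
  gcongr
  · exact (mul_le_of_le_one_left (norm_nonneg _) h1).trans h2
  · linarith

theorem integrableOn_bergmanOp_integrand {φ : ℂ → ℂ} (hφ : ContinuousOn φ (ball (0 : ℂ) 1))
    {M : ℝ} (hM : ∀ z ∈ ball (0 : ℂ) 1, ‖φ z‖ ≤ M) (m k : ℕ) {z : ℂ} (hz : ‖z‖ < 1) :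
    IntegrableOn (fun x : ℝ × ℝ => (1 - x.1 : ℂ) ^ m * φ (polarPoint x) /
      (1 - z * (starRingEnd ℂ) (polarPoint x)) ^ k) polarStrip :=
  IntegrableOn.of_bound volume_polarStrip_lt_top
    ((continuousOn_bergmanOp_integrand hφ m k hz).aestronglyMeasurable measurableSet_polarStrip)
    (M / (1 - ‖z‖) ^ k) ((ae_restrict_iff' measurableSet_polarStrip).2
      (.of_forall fun _ hx => norm_bergmanOp_integrand_le hM m k hz le_rfl hx))

theorem differentiableOn_bergmanOp {φ : ℂ → ℂ} (hφ : ContinuousOn φ (ball (0 : ℂ) 1))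
    {M : ℝ} (hM : ∀ z ∈ ball (0 : ℂ) 1, ‖φ z‖ ≤ M) (m : ℕ) :
    DifferentiableOn ℂ (bergmanOp m φ) (ball (0 : ℂ) 1) := by
  intro z₀ hz₀
  rw [mem_ball_zero_iff] at hz₀
  refine DifferentiableAt.differentiableWithinAt ?_
  unfold bergmanOp
  refine DifferentiableAt.const_mul ?_ _
  set ρ := (1 + ‖z₀‖) / 2 with hρ
  have hρ1 : ρ < 1 := by rw [hρ]; linarith
  have hφ' : ContinuousOn (fun w => (m + 2 : ℂ) * (starRingEnd ℂ) w * φ w) (ball (0 : ℂ) 1) :=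
    (continuousOn_const.mul Complex.continuous_conj.continuousOn).mul hφ
  have hM' : ∀ w ∈ ball (0 : ℂ) 1, ‖(m + 2 : ℂ) * (starRingEnd ℂ) w * φ w‖ ≤ (m + 2) * M := by
    intro w hw
    rw [norm_mul, norm_mul, RCLike.norm_conj]
    have h1 : ‖(m + 2 : ℂ)‖ = m + 2 := by
      have : (m + 2 : ℂ) = ((m + 2 : ℕ) : ℂ) := by push_cast; ring
      rw [this, Complex.norm_natCast]; push_cast; ring
    rw [h1]
    have hw' := mem_ball_zero_iff.1 hw
    gcongr
    · exact mul_le_of_le_one_right (by positivity) hw'.le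
    · exact hM w hw
  have hs : ball (0 : ℂ) ρ ∈ nhds z₀ :=
    isOpen_ball.mem_nhds (mem_ball_zero_iff.2 (by rw [hρ]; linarith))
  refine (hasDerivAt_integral_of_dominated_loc_of_deriv_le (𝕜 := ℂ)
    (μ := volume.restrict polarStrip) (x₀ := z₀)
    (F := fun z x => (1 - x.1 : ℂ) ^ m * φ (polarPoint x) /
      (1 - z * (starRingEnd ℂ) (polarPoint x)) ^ (m + 2))
    (F' := fun z x => (1 - x.1 : ℂ) ^ m *
      ((m + 2 : ℂ) * (starRingEnd ℂ) (polarPoint x) * φ (polarPoint x)) /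
      (1 - z * (starRingEnd ℂ) (polarPoint x)) ^ (m + 3))
    (bound := fun _ => (m + 2) * M / (1 - ρ) ^ (m + 3))
    hs ?_ ?_ ?_ ?_ ?_ ?_).2.differentiableAt
  · filter_upwards [hs] with z hz
    exact (integrableOn_bergmanOp_integrand hφ hM m _
      ((mem_ball_zero_iff.1 hz).trans hρ1)).aestronglyMeasurable
  · exact integrableOn_bergmanOp_integrand hφ hM m _ hz₀
  · exact (integrableOn_bergmanOp_integrand hφ' hM' m (m + 3) hz₀).aestronglyMeasurable
  · refine (ae_restrict_iff' measurableSet_polarStrip).2 (.of_forall fun x hx z hz => ?_)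
    exact norm_bergmanOp_integrand_le hM' m (m + 3) hρ1 (mem_ball_zero_iff.1 hz).le hx
  · exact integrableOn_const volume_polarStrip_lt_top.ne
  · refine (ae_restrict_iff' measurableSet_polarStrip).2 (.of_forall fun x hx z hz => ?_)
    have hne := one_sub_mul_conj_ne_zero ((mem_ball_zero_iff.1 hz).trans hρ1)
      (norm_polarPoint_lt_one hx)
    have h1 : HasDerivAt (fun z => 1 - z * (starRingEnd ℂ) (polarPoint x))
        (-(starRingEnd ℂ) (polarPoint x)) z := by
      simpa using ((hasDerivAt_id z).mul_const ((starRingEnd ℂ) (polarPoint x))).const_sub 1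
    have h2 := ((h1.fun_pow (m + 2)).fun_inv (pow_ne_zero _ hne)).const_mul
      ((1 - x.1 : ℂ) ^ m * φ (polarPoint x))
    refine h2.congr_deriv ?_
    simp only [Nat.add_succ_sub_one]
    field_simp
    push_cast
    ring

/-- The circle integral appearing in the Bergman projection does not depend on the radius. -/
theorem circleIntegral_kernel_eq {f : ℂ → ℂ} (hf : DifferentiableOn ℂ f (ball (0 : ℂ) 1)) (m : ℕ)
    {a : ℂ} {s R : ℝ} (has : ‖a‖ < s) (hsR : s ≤ R) (hR : R < 1) :
    (∮ w in C(0, s), f w * w ^ (m + 1) / (w - a) ^ (m + 2)) =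
      ∮ w in C(0, R), f w * w ^ (m + 1) / (w - a) ^ (m + 2) := by
  have hd : DifferentiableOn ℂ (fun w => f w * w ^ (m + 1) / (w - a) ^ (m + 2))
      (ball (0 : ℂ) 1 \ closedBall 0 ‖a‖) := by
    refine DifferentiableOn.div ((hf.mono sdiff_subset).mul (by fun_prop)) (by fun_prop) ?_
    intro w hw
    refine pow_ne_zero _ (sub_ne_zero.2 ?_)
    rintro rfl
    exact hw.2 (by simp)
  have hsub : closedBall (0 : ℂ) R \ ball 0 s ⊆ ball (0 : ℂ) 1 \ closedBall 0 ‖a‖ := by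
    intro w hw
    simp only [mem_sdiff, mem_closedBall_zero_iff, mem_ball_zero_iff, not_lt, not_le] at hw ⊢
    exact ⟨hw.1.trans_lt hR, has.trans_le hw.2⟩
  refine (Complex.circleIntegral_eq_of_differentiable_on_annulus_off_countable
    ((norm_nonneg a).trans_lt has) hsR countable_empty (hd.continuousOn.mono hsub) ?_).symm
  rintro w ⟨hw, -⟩
  refine hd.differentiableAt ((isOpen_ball.sdiff isClosed_closedBall).mem_nhds (hsub ?_))
  exact ⟨ball_subset_closedBall hw.1, fun h => hw.2 (ball_subset_closedBall h)⟩

theorem intervalIntegral_circle_kernel_eq {f : ℂ → ℂ}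
    (hf : DifferentiableOn ℂ f (ball (0 : ℂ) 1)) (m : ℕ)
    {a : ℂ} {s R : ℝ} (has : ‖a‖ < s) (haR : ‖a‖ < R) (hs : s < 1) (hR : R < 1) :
    ∫ θ in (0 : ℝ)..2 * Real.pi,
        f (circleMap 0 s θ) * circleMap 0 s θ ^ (m + 2) / (circleMap 0 s θ - a) ^ (m + 2) =
      ∫ θ in (0 : ℝ)..2 * Real.pi,
        f (circleMap 0 R θ) * circleMap 0 R θ ^ (m + 2) / (circleMap 0 R θ - a) ^ (m + 2) := by
  have key : ∀ t : ℝ, ∫ θ in (0 : ℝ)..2 * Real.pi,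
        f (circleMap 0 t θ) * circleMap 0 t θ ^ (m + 2) / (circleMap 0 t θ - a) ^ (m + 2) =
      (-Complex.I) * ∮ w in C(0, t), f w * w ^ (m + 1) / (w - a) ^ (m + 2) := by
    intro t
    rw [circleIntegral, ← intervalIntegral.integral_const_mul]
    congr 1
    ext θ
    rw [deriv_circleMap, smul_eq_mul]
    linear_combination ((f (circleMap 0 t θ) * circleMap 0 t θ ^ (m + 2) /
      (circleMap 0 t θ - a) ^ (m + 2))) * Complex.I_mul_I
  rw [key, key]
  rcases le_total s R with h | h
  · rw [circleIntegral_kernel_eq hf m has h hR]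
  · rw [circleIntegral_kernel_eq hf m haR h hs]

theorem intervalIntegral_radial_kernel (m : ℕ) {w z : ℂ} (hzw : ‖z‖ < ‖w‖) :
    ∫ u in (0 : ℝ)..1, (1 - u : ℂ) ^ m / (w - u * z) ^ (m + 2) =
      1 / ((m + 1) * w ^ (m + 1) * (w - z)) := by
  have hw : w ≠ 0 := norm_pos_iff.1 ((norm_nonneg z).trans_lt hzw)
  have hwz : w - z ≠ 0 := sub_ne_zero.2 (by rintro rfl; exact lt_irrefl _ hzw)
  have hne : ∀ u ∈ uIcc (0 : ℝ) 1, w - u * z ≠ 0 := by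
    intro u hu h
    rw [uIcc_of_le zero_le_one] at hu
    have h1 : ‖w‖ = ‖(u : ℂ) * z‖ := by rw [sub_eq_zero.1 h]
    rw [norm_mul, Complex.norm_real, Real.norm_of_nonneg hu.1] at h1
    nlinarith [hu.2, norm_nonneg z]
  have hm : (m + 1 : ℂ) ≠ 0 := by exact_mod_cast m.succ_ne_zero
  have hderiv : ∀ u ∈ uIcc (0 : ℝ) 1, HasDerivAt
      (fun u : ℝ => (-1 / ((m + 1) * (w - z))) * ((1 - u : ℂ) ^ (m + 1) / (w - u * z) ^ (m + 1)))
      ((1 - u : ℂ) ^ m / (w - u * z) ^ (m + 2)) u := by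
    intro u hu
    have h0 : HasDerivAt (fun u : ℝ => (u : ℂ)) 1 u := Complex.ofRealCLM.hasDerivAt
    have h1 : HasDerivAt (fun u : ℝ => (1 - u : ℂ)) (-1) u := h0.const_sub 1
    have h2 : HasDerivAt (fun u : ℝ => (w - u * z : ℂ)) (-z) u := by
      simpa using (h0.mul_const z).const_sub w
    have h3 := ((h1.fun_pow (m + 1)).fun_div (h2.fun_pow (m + 1))
      (pow_ne_zero _ (hne u hu))).const_mul (-1 / ((m + 1) * (w - z)))
    refine h3.congr_deriv ?_
    have hv := hne u hu
    simp only [Nat.add_succ_sub_one, add_zero]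
    push_cast
    have hnum : (m + 1 : ℂ) * (1 - u) ^ m * -1 * (w - u * z) ^ (m + 1) -
        (1 - u) ^ (m + 1) * ((m + 1) * (w - u * z) ^ m * -z) =
        -((m + 1) * (w - z) * ((1 - u) ^ m * (w - u * z) ^ m)) := by
      ring
    rw [hnum]
    generalize w - u * z = v at hv ⊢
    field_simp
    ring
  rw [intervalIntegral.integral_eq_sub_of_hasDerivAt hderiv]
  · simp only [Complex.ofReal_one, Complex.ofReal_zero]
    rw [sub_self, zero_pow m.succ_ne_zero]
    simp
    field_simp
  · refine ContinuousOn.intervalIntegrable (ContinuousOn.div (by fun_prop) (by fun_prop) ?_)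
    exact fun u hu => pow_ne_zero _ (hne u hu)

/-- The Bergman projection reproduces bounded holomorphic functions. -/
theorem bergmanOp_eq_self {f : ℂ → ℂ} (hf : DifferentiableOn ℂ f (ball (0 : ℂ) 1))
    {M : ℝ} (hM : ∀ z ∈ ball (0 : ℂ) 1, ‖f z‖ ≤ M) (m : ℕ) {z : ℂ} (hz : ‖z‖ < 1) :
    bergmanOp m f z = f z := by
  have hint := integrableOn_bergmanOp_integrand hf.continuousOn hM m (m + 2) hz
  set R := (1 + ‖z‖) / 2 with hR
  have hR1 : R < 1 := by rw [hR]; linarith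
  have hzR : ‖z‖ < R := by rw [hR]; linarith
  have hR0 : 0 < R := (norm_nonneg z).trans_lt hzR
  have hpi := Real.pi_pos
  have hnorm : ∀ θ, ‖circleMap 0 R θ‖ = R := fun θ => by
    rw [norm_circleMap_zero, abs_of_pos hR0]
  have hcirc : ∀ u ∈ Ioo (0 : ℝ) 1, ∫ θ in Ioo 0 (2 * Real.pi), (1 - u : ℂ) ^ m *
      f (polarPoint (u, θ)) / (1 - z * (starRingEnd ℂ) (polarPoint (u, θ))) ^ (m + 2) =
      ∫ θ in (0 : ℝ)..2 * Real.pi, (f (circleMap 0 R θ) * circleMap 0 R θ ^ (m + 2)) *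
        ((1 - u : ℂ) ^ m / (circleMap 0 R θ - u * z) ^ (m + 2)) := by
    intro u hu
    have hs1 : √u < 1 := by rw [Real.sqrt_lt' one_pos]; simpa using hu.2
    have hs0 : 0 < √u := Real.sqrt_pos.2 hu.1
    have hus : √u * √u = u := Real.mul_self_sqrt hu.1.le
    have hnuz : ‖(u : ℂ) * z‖ = u * ‖z‖ := by
      rw [norm_mul, Complex.norm_real, Real.norm_of_nonneg hu.1.le]
    have h1 := intervalIntegral_circle_kernel_eq hf m (a := u * z) (s := √u) (R := R)
      (by rw [hnuz]; nlinarith [norm_nonneg z]) (by rw [hnuz]; nlinarith [norm_nonneg z, hu.2])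
      hs1 hR1
    rw [← integral_Ioc_eq_integral_Ioo, ← intervalIntegral.integral_of_le (by positivity)]
    have hl : ∀ θ : ℝ, (1 - u : ℂ) ^ m * f (polarPoint (u, θ)) /
        (1 - z * (starRingEnd ℂ) (polarPoint (u, θ))) ^ (m + 2) = (1 - u : ℂ) ^ m *
        (f (circleMap 0 (√u) θ) * circleMap 0 (√u) θ ^ (m + 2) /
          (circleMap 0 (√u) θ - u * z) ^ (m + 2)) := by
      intro θ
      simp only [polarPoint]
      set w := circleMap 0 (√u) θ with hw
      have hww : w * (starRingEnd ℂ) w = u := by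
        rw [Complex.mul_conj', hw, norm_circleMap_zero, abs_of_pos hs0, sq,
          ← Complex.ofReal_mul, hus]
      have hw0 : w ≠ 0 := by
        rintro h0
        rw [h0, zero_mul] at hww
        exact hu.1.ne (by exact_mod_cast hww)
      have : w - u * z = w * (1 - z * (starRingEnd ℂ) w) := by
        linear_combination z * hww
      rw [this, mul_pow, mul_comm (f w), mul_div_mul_left _ _ (pow_ne_zero _ hw0)]
      ring
    simp_rw [hl]
    rw [intervalIntegral.integral_const_mul, h1, ← intervalIntegral.integral_const_mul]
    congr 1
    ext θ
    ring
  have hswap : IntegrableOn (Function.uncurry fun (u θ : ℝ) =>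
      (f (circleMap 0 R θ) * circleMap 0 R θ ^ (m + 2)) *
        ((1 - u : ℂ) ^ m / (circleMap 0 R θ - u * z) ^ (m + 2)))
      (uIoc 0 1 ×ˢ uIoc 0 (2 * Real.pi)) := by
    have hcont : ContinuousOn (Function.uncurry fun (u θ : ℝ) =>
      (f (circleMap 0 R θ) * circleMap 0 R θ ^ (m + 2)) *
        ((1 - u : ℂ) ^ m / (circleMap 0 R θ - u * z) ^ (m + 2)))
        (Icc 0 1 ×ˢ Icc 0 (2 * Real.pi)) := by
      have hc : Continuous fun x : ℝ × ℝ => circleMap 0 R x.2 := by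
        unfold circleMap; fun_prop
      refine ContinuousOn.mul (ContinuousOn.mul (hf.continuousOn.comp hc.continuousOn ?_)
        (hc.pow _).continuousOn) (ContinuousOn.div (by fun_prop) ?_ ?_)
      · intro x _
        rw [mem_ball_zero_iff, hnorm]
        exact hR1
      · exact ((hc.sub (by fun_prop)).pow _).continuousOn
      · rintro ⟨u, θ⟩ ⟨hu, -⟩
        refine pow_ne_zero _ (sub_ne_zero.2 fun h => ?_)
        have h1 := congrArg norm h
        simp only at h1 hu
        rw [hnorm, norm_mul, Complex.norm_real, Real.norm_of_nonneg hu.1] at h1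
        nlinarith [hu.2, norm_nonneg z]
    rw [uIoc_of_le zero_le_one, uIoc_of_le (by positivity)]
    exact (hcont.integrableOn_compact (isCompact_Icc.prod isCompact_Icc)).mono_set
      (prod_mono Ioc_subset_Icc_self Ioc_subset_Icc_self)
  have hcauchy : ∫ θ in (0 : ℝ)..2 * Real.pi,
      circleMap 0 R θ / (circleMap 0 R θ - z) * f (circleMap 0 R θ) = (2 * Real.pi : ℂ) * f z := by
    have hd : DiffContOnCl ℂ f (ball (0 : ℂ) |R|) := by
      rw [abs_of_pos hR0]
      refine DifferentiableOn.diffContOnCl (hf.mono ?_)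
      exact closure_ball_subset_closedBall.trans (closedBall_subset_ball hR1)
    have h := hd.circleAverage_smul_div (w := z) (by rw [abs_of_pos hR0]; simpa using hzR)
    rw [Real.circleAverage_def, Complex.real_smul] at h
    simp only [sub_zero, smul_eq_mul] at h
    rw [← h]
    push_cast
    field_simp
  have hm : (m + 1 : ℂ) ≠ 0 := by exact_mod_cast m.succ_ne_zero
  have hpi' : (Real.pi : ℂ) ≠ 0 := by exact_mod_cast hpi.ne'
  have htotal : ∫ x in polarStrip, (1 - x.1 : ℂ) ^ m * f (polarPoint x) /
      (1 - z * (starRingEnd ℂ) (polarPoint x)) ^ (m + 2) =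
      (1 / (m + 1)) * ((2 * Real.pi : ℂ) * f z) := by
    unfold polarStrip at hint ⊢
    rw [Measure.volume_eq_prod] at hint ⊢
    rw [setIntegral_prod _ hint, setIntegral_congr_fun measurableSet_Ioo hcirc,
      ← integral_Ioc_eq_integral_Ioo, ← intervalIntegral.integral_of_le zero_le_one,
      intervalIntegral_intervalIntegral_swap hswap, ← hcauchy,
      ← intervalIntegral.integral_const_mul]
    congr 1
    ext θ
    have hw : circleMap 0 R θ ≠ 0 := norm_pos_iff.1 (by rw [hnorm]; exact hR0)
    have hwz : circleMap 0 R θ - z ≠ 0 := sub_ne_zero.2 fun h => by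
      rw [← h, hnorm] at hzR; exact lt_irrefl _ hzR
    rw [intervalIntegral.integral_const_mul,
      intervalIntegral_radial_kernel m (by rw [hnorm]; exact hzR)]
    field_simp
    ring
  rw [bergmanOp, htotal]
  field_simp

theorem norm_mul_conj_pow_le {f B : ℂ → ℂ} {M : ℝ} (hM : ∀ z ∈ ball (0 : ℂ) 1, ‖f z‖ ≤ M)
    (hB1 : ∀ z ∈ ball (0 : ℂ) 1, ‖B z‖ ≤ 1) (j : ℕ) {w : ℂ} (hw : w ∈ ball (0 : ℂ) 1) :
    ‖f w * (starRingEnd ℂ) (B w) ^ j‖ ≤ M := by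
  rw [norm_mul, norm_pow, RCLike.norm_conj]
  exact (mul_le_of_le_one_right (norm_nonneg _)
    (pow_le_one₀ (norm_nonneg _) (hB1 w hw))).trans (hM w hw)

theorem sum_choose_mul_bergmanOp {f B : ℂ → ℂ} (hf : ContinuousOn f (ball (0 : ℂ) 1)) {M : ℝ}
    (hM : ∀ z ∈ ball (0 : ℂ) 1, ‖f z‖ ≤ M) (hB : ContinuousOn B (ball (0 : ℂ) 1))
    (hB1 : ∀ z ∈ ball (0 : ℂ) 1, ‖B z‖ ≤ 1) (m N : ℕ) (b : ℂ) {z : ℂ} (hz : ‖z‖ < 1) :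
    ∑ j ∈ Finset.range (N + 1), (N.choose j * (-1) ^ j * b ^ j : ℂ) *
        bergmanOp m (fun w => f w * (starRingEnd ℂ) (B w) ^ j) z =
      bergmanOp m (fun w => f w * (1 - b * (starRingEnd ℂ) (B w)) ^ N) z := by
  have hexp : ∀ w, f w * (1 - b * (starRingEnd ℂ) (B w)) ^ N =
      ∑ j ∈ Finset.range (N + 1), (N.choose j * (-1) ^ j * b ^ j : ℂ) *
        (f w * (starRingEnd ℂ) (B w) ^ j) := by
    intro w
    rw [sub_eq_neg_add, add_pow, Finset.mul_sum]
    refine Finset.sum_congr rfl fun j _ => ?_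
    rw [one_pow, neg_pow, mul_pow]
    ring
  have hint : ∀ j, IntegrableOn (fun x : ℝ × ℝ => (1 - x.1 : ℂ) ^ m *
      (f (polarPoint x) * (starRingEnd ℂ) (B (polarPoint x)) ^ j) /
      (1 - z * (starRingEnd ℂ) (polarPoint x)) ^ (m + 2)) polarStrip := by
    intro j
    refine integrableOn_bergmanOp_integrand (φ := fun w => f w * (starRingEnd ℂ) (B w) ^ j)
      (M := M) (hf.mul ((Complex.continuous_conj.comp_continuousOn hB).pow j)) ?_ m _ hz
    exact fun w hw => norm_mul_conj_pow_le hM hB1 j hw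
  simp only [bergmanOp]
  simp_rw [hexp, Finset.mul_sum, Finset.sum_div]
  rw [integral_finsetSum]
  · rw [Finset.mul_sum]
    refine Finset.sum_congr rfl fun j _ => ?_
    rw [mul_left_comm, ← integral_const_mul]
    congr 2
    ext x
    ring
  · intro j _
    refine ((hint j).const_mul (N.choose j * (-1) ^ j * b ^ j : ℂ)).congr (.of_forall fun x => ?_)
    simp only
    ring

theorem integral_rpow_one_sub_mul_le {ρ a : ℝ} (hρ : 1 / 2 ≤ ρ) (hρ1 : ρ < 1) (ha : 0 < a) :
    ∫ u in (0 : ℝ)..1, (1 - ρ * u) ^ (-a - 1) ≤ 2 / a * (1 - ρ) ^ (-a) := by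
  have hpos : ∀ u ∈ uIcc (0 : ℝ) 1, 0 < 1 - ρ * u := by
    intro u hu
    rw [uIcc_of_le zero_le_one] at hu
    nlinarith [hu.1, hu.2]
  have hderiv : ∀ u ∈ uIcc (0 : ℝ) 1, HasDerivAt
      (fun u => 1 / (a * ρ) * (1 - ρ * u) ^ (-a)) ((1 - ρ * u) ^ (-a - 1)) u := by
    intro u hu
    have h1 : HasDerivAt (fun u => 1 - ρ * u) (-ρ) u := by
      simpa using ((hasDerivAt_id u).const_mul ρ).const_sub 1
    refine ((h1.rpow_const (.inl (hpos u hu).ne')).const_mul (1 / (a * ρ))).congr_deriv ?_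
    have : ρ ≠ 0 := by linarith
    field_simp
  rw [intervalIntegral.integral_eq_sub_of_hasDerivAt hderiv]
  · have h1 : 0 < (1 - ρ) ^ (-a) := Real.rpow_pos_of_pos (by linarith) _
    have h2 : 1 / (a * ρ) ≤ 2 / a := by
      rw [div_le_div_iff₀ (by positivity) ha]
      nlinarith
    have h3 : 0 < 1 / (a * ρ) := by positivity
    simp only [mul_one, mul_zero, sub_zero, Real.one_rpow]
    nlinarith
  · refine ContinuousOn.intervalIntegrable (ContinuousOn.rpow_const (by fun_prop) ?_)
    exact fun u hu => .inl (hpos u hu).ne'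

/-- The function `(1 - ρ u)^s / |1 - ρ z conj(w)|^(m + 2)`, with `w = √u e^{iθ}`. -/
def kernelMajorant (m : ℕ) (ρ s : ℝ) (z : ℂ) (x : ℝ × ℝ) : ℝ :=
  (1 - ρ * x.1) ^ s / ‖1 - ρ * z * (starRingEnd ℂ) (polarPoint x)‖ ^ (m + 2)

theorem integrableOn_kernelMajorant (m : ℕ) {ρ : ℝ} (s : ℝ) {z : ℂ} (hρ0 : 0 ≤ ρ) (hρ1 : ρ < 1)
    (hz : ‖z‖ < 1) : IntegrableOn (kernelMajorant m ρ s z) polarStrip := by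
  have hc : ContinuousOn (kernelMajorant m ρ s z) (Icc 0 1 ×ˢ Icc 0 (2 * Real.pi)) := by
    unfold kernelMajorant
    refine ContinuousOn.div (ContinuousOn.rpow_const (by fun_prop) ?_) (by fun_prop) ?_
    · rintro x ⟨hx, -⟩
      refine .inl (ne_of_gt ?_)
      nlinarith [hx.1, hx.2]
    · rintro x ⟨hx, -⟩
      refine pow_ne_zero _ (norm_ne_zero_iff.2 fun h => ?_)
      have h1 := congrArg norm (sub_eq_zero.1 h)
      rw [norm_one, norm_mul, norm_mul, RCLike.norm_conj, norm_polarPoint, Complex.norm_real,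
        Real.norm_of_nonneg hρ0] at h1
      have h2 : √x.1 ≤ 1 := Real.sqrt_le_one.2 hx.2
      have h3 : ρ * ‖z‖ < 1 := by nlinarith [norm_nonneg z]
      nlinarith [Real.sqrt_nonneg x.1, mul_nonneg hρ0 (norm_nonneg z)]
  exact (hc.integrableOn_compact (isCompact_Icc.prod isCompact_Icc)).mono_set
    (prod_mono Ioo_subset_Icc_self Ioo_subset_Icc_self)

theorem integral_kernelMajorant_le (m : ℕ) {ρ a : ℝ} {z : ℂ} (hρ : 1 / 2 ≤ ρ) (hρ1 : ρ < 1)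
    (ha : 0 < a) (hz : ‖z‖ < 1) :
    ∫ x in polarStrip, kernelMajorant m ρ (m - a) z x ≤
      2 * Real.pi * 2 ^ (m + 1) * (2 / a) * (1 - ρ) ^ (-a) := by
  have hρ0 : 0 ≤ ρ := by linarith
  have hpi := Real.pi_pos
  have hint := integrableOn_kernelMajorant m (m - a) hρ0 hρ1 hz
  have hinner : ∀ u ∈ Ioo (0 : ℝ) 1,
      ∫ θ in Ioo 0 (2 * Real.pi), kernelMajorant m ρ (m - a) z (u, θ) ≤
        2 * Real.pi * 2 ^ (m + 1) * (1 - ρ * u) ^ (-a - 1) := by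
    intro u hu
    have hs1 : √u < 1 := by rw [Real.sqrt_lt' one_pos]; simpa using hu.2
    have hs0 : 0 ≤ √u := Real.sqrt_nonneg u
    have hus : √u * √u = u := Real.mul_self_sqrt hu.1.le
    have hpos : 0 < 1 - ρ * u := by nlinarith [hu.1, hu.2]
    set ζ : ℂ := ρ * z * √u with hζ
    have hζn : ‖ζ‖ ≤ ρ * √u := by
      rw [hζ, norm_mul, norm_mul, Complex.norm_real, Complex.norm_real,
        Real.norm_of_nonneg hρ0, Real.norm_of_nonneg hs0]
      gcongr
      exact mul_le_of_le_one_right hρ0 hz.le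
    have hgap : (1 - ρ * u) / 2 ≤ 1 - ‖ζ‖ := by
      nlinarith [sq_nonneg (1 - √u)]
    have hζ1 : ‖ζ‖ < 1 := by linarith
    have hk : ∀ θ, kernelMajorant m ρ (m - a) z (u, θ) = (1 - ρ * u) ^ (m - a) *
        (1 / ‖1 - ζ * (starRingEnd ℂ) (circleMap 0 1 θ)‖ ^ (m + 2)) := by
      intro θ
      have : ρ * z * (starRingEnd ℂ) (polarPoint (u, θ)) =
          ζ * (starRingEnd ℂ) (circleMap 0 1 θ) := by
        simp only [polarPoint, circleMap, hζ, map_mul, Complex.conj_ofReal, zero_add,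
          Complex.ofReal_one, one_mul]
        ring
      rw [kernelMajorant, this, mul_one_div]
    simp_rw [hk]
    rw [integral_const_mul, ← integral_Ioc_eq_integral_Ioo,
      ← intervalIntegral.integral_of_le (by positivity)]
    calc _ ≤ (1 - ρ * u) ^ ((m : ℝ) - a) * (2 * Real.pi * (1 / (1 - ‖ζ‖)) ^ (m + 1)) := by
          gcongr
          exact integral_inv_norm_one_sub_mul_conj_pow_le hζ1 m
      _ ≤ (1 - ρ * u) ^ ((m : ℝ) - a) * (2 * Real.pi * (1 / ((1 - ρ * u) / 2)) ^ (m + 1)) := by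
          gcongr
      _ = 2 * Real.pi * 2 ^ (m + 1) * (1 - ρ * u) ^ (-a - 1) := by
          have h1 : (1 - ρ * u) ^ (-a - 1) =
              (1 - ρ * u) ^ ((m : ℝ) - a) / (1 - ρ * u) ^ (m + 1) := by
            rw [← Real.rpow_natCast, ← Real.rpow_sub hpos]
            congr 1
            push_cast
            ring
          rw [h1, one_div_div, div_pow]
          ring
  have hpow : IntegrableOn (fun u : ℝ => 2 * Real.pi * 2 ^ (m + 1) * (1 - ρ * u) ^ (-a - 1))
      (Ioo 0 1) := by
    have hc : ContinuousOn (fun u : ℝ => 2 * Real.pi * 2 ^ (m + 1) * (1 - ρ * u) ^ (-a - 1))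
        (Icc 0 1) := by
      refine continuousOn_const.mul (ContinuousOn.rpow_const (by fun_prop) fun u hu => .inl ?_)
      refine ne_of_gt ?_
      nlinarith [hu.1, hu.2]
    exact (hc.integrableOn_compact isCompact_Icc).mono_set Ioo_subset_Icc_self
  unfold polarStrip at hint ⊢
  rw [Measure.volume_eq_prod] at hint ⊢
  rw [setIntegral_prod _ hint]
  have hint' : IntegrableOn (fun u => ∫ θ in Ioo 0 (2 * Real.pi),
      kernelMajorant m ρ (m - a) z (u, θ)) (Ioo 0 1) := by
    rw [IntegrableOn, ← Measure.prod_restrict] at hint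
    exact hint.integral_prod_left
  calc _ ≤ ∫ u in Ioo (0 : ℝ) 1, 2 * Real.pi * 2 ^ (m + 1) * (1 - ρ * u) ^ (-a - 1) :=
        setIntegral_mono_on hint' hpow measurableSet_Ioo hinner
    _ = 2 * Real.pi * 2 ^ (m + 1) * ∫ u in (0 : ℝ)..1, (1 - ρ * u) ^ (-a - 1) := by
        rw [integral_const_mul, ← integral_Ioc_eq_integral_Ioo,
          ← intervalIntegral.integral_of_le zero_le_one]
    _ ≤ 2 * Real.pi * 2 ^ (m + 1) * (2 / a * (1 - ρ) ^ (-a)) := by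
        gcongr
        exact integral_rpow_one_sub_mul_le hρ hρ1 ha
    _ = _ := by ring

theorem norm_bergmanOp_blaschkeProd_le {n : ℕ} (hn : 1 ≤ n) {σ : Fin n → ℂ} {r : ℝ} (hr0 : 0 ≤ r)
    (hr : r < 1) (hσ : ∀ i, ‖σ i‖ ≤ r) {f : ℂ → ℂ} {A a : ℝ} (hA : 0 < A) (ha : 0 < a)
    (hf : ∀ w ∈ ball (0 : ℂ) 1, ‖f w‖ ≤ A * (1 - ‖w‖) ^ (-a)) {m : ℕ} (hm : a ≤ m) {z : ℂ}
    (hz : ‖z‖ < 1) :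
    ‖bergmanOp m (fun w => f w *
        (1 - blaschkeProd σ z * (starRingEnd ℂ) (blaschkeProd σ w)) ^ (m + 2)) z‖ ≤
      (m + 1) * (A * 2 ^ a * 3 ^ (m + 2)) * (2 ^ (m + 1) * (2 / a) * 2 ^ a) *
        (n / (1 - r)) ^ a := by
  have hpi := Real.pi_pos
  have hn1 : (1 : ℝ) ≤ n := by exact_mod_cast hn
  have hr1 : 0 < 1 - r := by linarith
  set ρ : ℝ := 1 - (1 - r) / (2 * n) with hρ
  have hδ : 0 < (1 - r) / (2 * n) := by positivity
  have hδ1 : (1 - r) / (2 * n) ≤ 1 / 2 := by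
    rw [div_le_div_iff₀ (by positivity) two_pos]
    linarith
  have hρh : 1 / 2 ≤ ρ := by linarith
  have hρ1 : ρ < 1 := by linarith
  have hρ0 : 0 ≤ ρ := by linarith
  have hpoint : ∀ x ∈ polarStrip, ‖(1 - x.1 : ℂ) ^ m * (f (polarPoint x) *
      (1 - blaschkeProd σ z * (starRingEnd ℂ) (blaschkeProd σ (polarPoint x))) ^ (m + 2)) /
      (1 - z * (starRingEnd ℂ) (polarPoint x)) ^ (m + 2)‖ ≤
      A * 2 ^ a * 3 ^ (m + 2) * kernelMajorant m ρ (m - a) z x := by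
    intro x hx
    have hw := norm_polarPoint_lt_one hx
    have hu0 : 0 < x.1 := hx.1.1
    have hu1 : x.1 < 1 := hx.1.2
    have hu : 0 < 1 - x.1 := by linarith
    have hgrowth : ‖f (polarPoint x)‖ ≤ A * (2 ^ a * (1 - x.1) ^ (-a)) := by
      refine (hf _ (mem_ball_zero_iff.2 hw)).trans (mul_le_mul_of_nonneg_left ?_ hA.le)
      have h1 : (1 - x.1) / 2 ≤ 1 - ‖polarPoint x‖ := by
        rw [norm_polarPoint] at hw ⊢
        nlinarith [Real.mul_self_sqrt hu0.le]
      refine (Real.rpow_le_rpow_of_nonpos (by positivity) h1 (by linarith)).trans_eq ?_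
      rw [Real.div_rpow hu.le two_pos.le, Real.rpow_neg two_pos.le, div_inv_eq_mul, mul_comm]
    have hker := norm_model_kernel_le hn hr hσ hz hw hρ0 hρ
    have hweight : (1 - x.1) ^ m * (1 - x.1) ^ (-a) ≤ (1 - ρ * x.1) ^ ((m : ℝ) - a) := by
      rw [← Real.rpow_natCast, ← Real.rpow_add hu, ← sub_eq_add_neg]
      refine Real.rpow_le_rpow hu.le ?_ (by linarith)
      nlinarith
    have hnorm : ‖(1 - x.1 : ℂ) ^ m‖ = (1 - x.1) ^ m := by
      rw [norm_pow, ← Complex.ofReal_one, ← Complex.ofReal_sub, Complex.norm_real,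
        Real.norm_of_nonneg hu.le]
    rw [← mul_assoc, mul_div_assoc, ← div_pow, norm_mul, norm_mul, hnorm, norm_pow]
    calc _ ≤ (1 - x.1) ^ m * (A * (2 ^ a * (1 - x.1) ^ (-a))) *
          (3 / ‖1 - ρ * z * (starRingEnd ℂ) (polarPoint x)‖) ^ (m + 2) := by
          gcongr
      _ = A * 2 ^ a * 3 ^ (m + 2) * (((1 - x.1) ^ m * (1 - x.1) ^ (-a)) /
          ‖1 - ρ * z * (starRingEnd ℂ) (polarPoint x)‖ ^ (m + 2)) := by
          rw [div_pow]
          ring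
      _ ≤ _ := by
          unfold kernelMajorant
          gcongr
  have hintegral := norm_integral_le_of_norm_le
    ((integrableOn_kernelMajorant m (m - a) hρ0 hρ1 hz).const_mul (A * 2 ^ a * 3 ^ (m + 2)))
    ((ae_restrict_iff' measurableSet_polarStrip).2 (.of_forall hpoint))
  rw [integral_const_mul] at hintegral
  have hconst : ‖((m + 1) / (2 * Real.pi) : ℂ)‖ = (m + 1) / (2 * Real.pi) := by
    have : ((m + 1) / (2 * Real.pi) : ℂ) = (((m + 1) / (2 * Real.pi) : ℝ) : ℂ) := by push_cast; rfl
    rw [this, Complex.norm_real, Real.norm_of_nonneg (by positivity)]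
  have hδa : (1 - ρ) ^ (-a) = 2 ^ a * (n / (1 - r)) ^ a := by
    rw [← Real.mul_rpow two_pos.le (by positivity), hρ, sub_sub_cancel, Real.rpow_neg hδ.le,
      ← Real.inv_rpow hδ.le, inv_div, mul_div_assoc]
  rw [bergmanOp, norm_mul, hconst]
  calc _ ≤ (m + 1) / (2 * Real.pi) * (A * 2 ^ a * 3 ^ (m + 2) *
        (2 * Real.pi * 2 ^ (m + 1) * (2 / a) * (1 - ρ) ^ (-a))) := by
        gcongr
        refine hintegral.trans ?_
        gcongr
        exact integral_kernelMajorant_le m hρh hρ1 ha hz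
    _ = _ := by
        rw [hδa]
        field_simp

/-- Upper bound in Theorem 2.1, weighted Bergman case: there is `C > 0` (depending
only on `p, β`) such that any `f ∈ Hol(D)` with `‖f‖_{A^p(β)} ≤ 1` and
`‖f‖_{H^∞} < ∞` admits an `H^∞` interpolant `g` on any `n`-tuple `σ ⊂ D` with
`max |λ_i| ≤ r`, with `‖g‖_{H^∞} ≤ C (n/(1-r))^{(2+β)/p}`. -/
theorem bergman_interpolation_upper_bound (p β : ℝ) (hp : 1 ≤ p) (hβ : -1 < β) :
    ∃ C : ℝ, 0 < C ∧
      ∀ (n : ℕ), 1 ≤ n → ∀ r : ℝ, 0 ≤ r → r < 1 →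
      ∀ σ : Fin n → ℂ, (∀ i, ‖σ i‖ ≤ r) →
      ∀ f : ℂ → ℂ, DifferentiableOn ℂ f (ball (0:ℂ) 1) →
      bergmanNorm p β f ≤ 1 →
      (∃ M : ℝ, ∀ z ∈ ball (0:ℂ) 1, ‖f z‖ ≤ M) →
      ∃ g : ℂ → ℂ, DifferentiableOn ℂ g (ball (0:ℂ) 1) ∧
        (∃ h : ℂ → ℂ, DifferentiableOn ℂ h (ball (0:ℂ) 1) ∧
          ∀ z ∈ ball (0:ℂ) 1, f z - g z = (∏ i, blaschkeF (σ i) z) * h z) ∧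
        ∀ z ∈ ball (0:ℂ) 1, ‖g z‖ ≤ C * ((n : ℝ) / (1 - r)) ^ ((2 + β) / p) := by
  obtain ⟨A, hA, hgrowth⟩ := exists_bergman_growth_bound hp hβ
  set a := (2 + β) / p
  have ha : 0 < a := div_pos (by linarith) (by linarith)
  obtain ⟨m, hm⟩ := exists_nat_ge a
  refine ⟨(m + 1) * (A * 2 ^ a * 3 ^ (m + 2)) * (2 ^ (m + 1) * (2 / a) * 2 ^ a), by positivity, ?_⟩
  intro n hn r hr0 hr σ hσ f hf hnorm hbdd
  have hf_le := hgrowth f hf hnorm hbdd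
  obtain ⟨M, hM⟩ := hbdd
  have hσ1 : ∀ i, ‖σ i‖ < 1 := fun i => (hσ i).trans_lt hr
  have hB := differentiableOn_blaschkeProd hσ1
  have hB1 : ∀ z ∈ ball (0 : ℂ) 1, ‖blaschkeProd σ z‖ ≤ 1 := fun z hz =>
    norm_blaschkeProd_le_one hσ1 (mem_ball_zero_iff.1 hz)
  have hT : ∀ j : ℕ, DifferentiableOn ℂ
      (bergmanOp m fun w => f w * (starRingEnd ℂ) (blaschkeProd σ w) ^ j) (ball (0 : ℂ) 1) :=
    fun j => differentiableOn_bergmanOp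
      (hf.continuousOn.mul ((Complex.continuous_conj.comp_continuousOn hB.continuousOn).pow j))
      (fun w hw => norm_mul_conj_pow_le hM hB1 j hw) m
  refine ⟨fun z => ∑ j ∈ Finset.range (m + 2 + 1),
    ((m + 2).choose j * (-1) ^ j * blaschkeProd σ z ^ j : ℂ) *
      bergmanOp m (fun w => f w * (starRingEnd ℂ) (blaschkeProd σ w) ^ j) z, ?_,
    ⟨fun z => -∑ j ∈ Finset.range (m + 2),
      ((m + 2).choose (j + 1) * (-1) ^ (j + 1) * blaschkeProd σ z ^ j : ℂ) *
        bergmanOp m (fun w => f w * (starRingEnd ℂ) (blaschkeProd σ w) ^ (j + 1)) z, ?_, ?_⟩, ?_⟩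
  · exact DifferentiableOn.fun_sum fun j _ => ((hB.pow j).const_mul _).mul (hT j)
  · exact (DifferentiableOn.fun_sum fun j _ => ((hB.pow j).const_mul _).mul (hT (j + 1))).neg
  · intro z hz
    have hself := bergmanOp_eq_self hf hM m (mem_ball_zero_iff.1 hz)
    beta_reduce
    rw [Finset.sum_range_succ']
    simp only [pow_zero, mul_one, Nat.choose_zero_right, Nat.cast_one, hself]
    rw [one_mul, sub_add_cancel_right, mul_neg, Finset.mul_sum]
    refine congrArg Neg.neg (Finset.sum_congr rfl fun j _ => ?_)
    rw [blaschkeProd]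
    ring
  · intro z hz
    have hz1 := mem_ball_zero_iff.1 hz
    beta_reduce
    rw [sum_choose_mul_bergmanOp hf.continuousOn hM hB.continuousOn hB1 m (m + 2) _ hz1]
    exact norm_bergmanOp_blaschkeProd_le hn hr0 hr hσ hA ha hf_le hm hz1
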